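/- (Clebsch–Gordan decomposition) For j₁, j₂ ∈ ½ℕ, the tensor product representation (H^{j₁} ⊗ H^{j₂}, ρ^{j₁} ⊗ ρ^{j₂}) of SU(2) is equivalent to the direct sum of the irreducible representations (H^J, ρ^J) for J = |j₁ − j₂|, |j₁ − j₂| + 1, …, j₁ + j₂, each occurring exactly once; that is, there is a bijective intertwining operator H^{j₁} ⊗ H^{j₂} ≅ ⊕_{J=|j₁−j₂|}^{j₁+j₂} H^J. -/

import Mathlib

open MvPolynomial TensorProduct

namespace CG

abbrev P := MvPolynomial (Fin 2) ℂ

lemma comp_monomial (n : ℕ) (d : Fin 2 →₀ ℕ) (a : ℂ) :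
    homogeneousComponent n (monomial d a : P) = if n = d.degree then monomial d a else 0 :=
  homogeneousComponent_of_mem ((mem_homogeneousSubmodule _ _).2 (isHomogeneous_monomial a rfl))

lemma comp_X_mul (n : ℕ) (i : Fin 2) (p : P) :
    homogeneousComponent (n + 1) (X i * p) = X i * homogeneousComponent n p := by
  induction p using MvPolynomial.induction_on' with
  | monomial d a =>
    have h : (X i : P) * monomial d a = monomial (Finsupp.single i 1 + d) a := by
      rw [X, monomial_mul, one_mul]
    rw [h, comp_monomial, comp_monomial]
    have : (Finsupp.single i 1 + d).degree = d.degree + 1 := by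
      simp [add_comm]
    rw [this]
    by_cases hn : n = d.degree
    · simp [hn, h]
    · simp [hn]
  | add p q hp hq => rw [mul_add, map_add, hp, hq, map_add, mul_add]

lemma comp_zero_X_mul (i : Fin 2) (p : P) :
    homogeneousComponent 0 (X i * p) = 0 := by
  rw [homogeneousComponent_zero, coeff_X_mul']
  simp

lemma comp_aeval (v : Fin 2 → P) (hv : ∀ i, (v i).IsHomogeneous 1) (n : ℕ) (p : P) :
    homogeneousComponent n (aeval v p) = aeval v (homogeneousComponent n p) := by
  induction p using MvPolynomial.induction_on' with
  | monomial d a =>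
    rw [comp_monomial]
    have h : (aeval v (monomial d a : P)).IsHomogeneous (1 * d.degree) :=
      (isHomogeneous_monomial a rfl).aeval v hv
    rw [one_mul] at h
    rw [homogeneousComponent_of_mem ((mem_homogeneousSubmodule _ _).2 h)]
    split_ifs <;> simp
  | add p q hp hq => rw [map_add, map_add, hp, hq, map_add, map_add]

/-- bihomogeneous component -/
noncomputable def bi (m n : ℕ) : P ⊗[ℂ] P →ₗ[ℂ] P ⊗[ℂ] P :=
  TensorProduct.map (homogeneousComponent m) (homogeneousComponent n)

noncomputable def Delta : P →ₐ[ℂ] P ⊗[ℂ] P :=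
  aeval fun i => X i ⊗ₜ[ℂ] 1 + 1 ⊗ₜ[ℂ] X i

noncomputable def mu : P ⊗[ℂ] P →ₐ[ℂ] P := Algebra.TensorProduct.lmul' ℂ

noncomputable def D : P ⊗[ℂ] P := X 0 ⊗ₜ[ℂ] X 1 - X 1 ⊗ₜ[ℂ] X 0

lemma mu_D : mu D = 0 := by
  simp [mu, D, mul_comm]

lemma bi_D_mul (m n : ℕ) (z : P ⊗[ℂ] P) : bi (m + 1) (n + 1) (D * z) = D * bi m n z := by
  induction z using TensorProduct.induction_on with
  | zero => simp
  | tmul p q => simp [bi, D, sub_mul, comp_X_mul]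
  | add a b ha hb => rw [mul_add, map_add, ha, hb, map_add, mul_add]

lemma bi_D_pow_mul (k m n : ℕ) (z : P ⊗[ℂ] P) :
    bi (m + k) (n + k) (D ^ k * z) = D ^ k * bi m n z := by
  induction k generalizing z with
  | zero => simp
  | succ k ih =>
    rw [pow_succ', mul_assoc, mul_assoc, ← add_assoc, ← add_assoc, bi_D_mul, ih]

lemma bi_left (m n : ℕ) (i : Fin 2) (z : P ⊗[ℂ] P) :
    bi (m + 1) n (X i ⊗ₜ[ℂ] 1 * z) = X i ⊗ₜ[ℂ] 1 * bi m n z := by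
  induction z using TensorProduct.induction_on with
  | zero => simp
  | tmul p q => simp [bi, comp_X_mul]
  | add a b ha hb => rw [mul_add, map_add, ha, hb, map_add, mul_add]

lemma bi_right (m n : ℕ) (i : Fin 2) (z : P ⊗[ℂ] P) :
    bi m (n + 1) (1 ⊗ₜ[ℂ] X i * z) = 1 ⊗ₜ[ℂ] X i * bi m n z := by
  induction z using TensorProduct.induction_on with
  | zero => simp
  | tmul p q => simp [bi, comp_X_mul]
  | add a b ha hb => rw [mul_add, map_add, ha, hb, map_add, mul_add]

lemma bi_left0 (n : ℕ) (i : Fin 2) (z : P ⊗[ℂ] P) :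
    bi 0 n (X i ⊗ₜ[ℂ] 1 * z) = 0 := by
  induction z using TensorProduct.induction_on with
  | zero => simp
  | tmul p q =>
    rw [Algebra.TensorProduct.tmul_mul_tmul, bi, TensorProduct.map_tmul, comp_zero_X_mul,
      TensorProduct.zero_tmul]
  | add a b ha hb => rw [mul_add, map_add, ha, hb, add_zero]

lemma bi_right0 (m : ℕ) (i : Fin 2) (z : P ⊗[ℂ] P) :
    bi m 0 (1 ⊗ₜ[ℂ] X i * z) = 0 := by
  induction z using TensorProduct.induction_on with
  | zero => simp
  | tmul p q =>
    rw [Algebra.TensorProduct.tmul_mul_tmul, bi, TensorProduct.map_tmul, comp_zero_X_mul,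
      TensorProduct.tmul_zero]
  | add a b ha hb => rw [mul_add, map_add, ha, hb, add_zero]

lemma comp_C (n : ℕ) (a : ℂ) :
    homogeneousComponent n (C a : P) = if n = 0 then C a else 0 :=
  homogeneousComponent_of_mem ((mem_homogeneousSubmodule _ _).2 (isHomogeneous_C _ a))

lemma mu_left (i : Fin 2) (z : P ⊗[ℂ] P) : mu (X i ⊗ₜ[ℂ] 1 * z) = X i * mu z := by
  rw [map_mul]; simp [mu]

lemma mu_right (i : Fin 2) (z : P ⊗[ℂ] P) : mu (1 ⊗ₜ[ℂ] X i * z) = X i * mu z := by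
  rw [map_mul]; simp [mu]

lemma mu_bi_Delta (m n : ℕ) (p : P) :
    mu (bi m n (Delta p)) = ((m + n).choose m : P) * homogeneousComponent (m + n) p := by
  induction p using MvPolynomial.induction_on generalizing m n with
  | C a =>
    have h : Delta (C a) = C a ⊗ₜ[ℂ] 1 := by
      simp only [Delta, algHom_C]
      rfl
    have h1 : (1 : P) = C 1 := rfl
    rw [h, bi, TensorProduct.map_tmul, comp_C, comp_C, h1, comp_C]
    rcases m with _ | m <;> rcases n with _ | n <;> simp [mu]
  | add p q hp hq => simp only [map_add, hp, hq, mul_add]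
  | mul_X p i ih =>
    rw [mul_comm p, map_mul]
    have h : Delta (X i) = X i ⊗ₜ[ℂ] 1 + 1 ⊗ₜ[ℂ] X i := by simp [Delta]
    rw [h, add_mul, map_add, map_add]
    rcases m with _ | m <;> rcases n with _ | n
    · rw [bi_left0, bi_right0, comp_zero_X_mul]; simp
    · rw [bi_left0, bi_right, mu_right, ih, ← add_assoc, comp_X_mul]; simp
    · rw [bi_left, bi_right0, mu_left, ih, add_zero, add_zero, comp_X_mul]; simp
    · rw [bi_left, bi_right, mu_left, mu_right, ih, ih,
        show m + 1 + (n + 1) = (m + (n + 1)) + 1 by ring, comp_X_mul,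
        show m + 1 + n = m + (n + 1) by ring, Nat.choose_succ_succ]
      push_cast
      ring

instance : IsDomain (P ⊗[ℂ] P) :=
  (MvPolynomial.algebraTensorAlgEquiv (σ := Fin 2) ℂ P).toMulEquiv.isDomain _

lemma D_ne : D ≠ 0 := by
  intro h
  have h2 := congrArg (Algebra.TensorProduct.lift
    (aeval ![(1 : ℂ), 0] : P →ₐ[ℂ] ℂ) (aeval ![(0 : ℂ), 1] : P →ₐ[ℂ] ℂ)
    (fun _ _ => Commute.all _ _)) h
  simp [D] at h2

lemma peel (N : ℕ) (w : Fin N → P ⊗[ℂ] P) (hw : ∀ k, mu (w k) = 0 → w k = 0)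
    (h : ∑ k : Fin N, D ^ (k : ℕ) * w k = 0) : ∀ k, w k = 0 := by
  induction N with
  | zero => exact fun k => k.elim0
  | succ N ih =>
    rw [Fin.sum_univ_succ] at h
    have h0 : w 0 = 0 := by
      apply hw
      have := congrArg mu h
      simpa [mu_D, pow_succ] using this
    have h1 : ∑ k : Fin N, D ^ (k : ℕ) * w k.succ = 0 := by
      have : D * ∑ k : Fin N, D ^ (k : ℕ) * w k.succ = 0 := by
        rw [Finset.mul_sum]
        simpa [h0, pow_succ', mul_assoc] using h
      exact (mul_eq_zero.1 this).resolve_left D_ne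
    have h2 := ih (fun k => w k.succ) (fun k => hw _) h1
    intro k
    induction k using Fin.cases with
    | zero => exact h0
    | succ k => exact h2 k

lemma finrank_homog (n : ℕ) : Module.finrank ℂ (homogeneousSubmodule (Fin 2) ℂ n) = n + 1 := by
  rw [homogeneousSubmodule_eq_finsupp_supported]
  rw [(AddMonoidAlgebra.supportedEquivFinsupp _).finrank_eq]
  have e : {d : Fin 2 →₀ ℕ | d.degree = n} ≃ Finset.HasAntidiagonal.antidiagonal n :=
    { toFun := fun d => ⟨(d.1 0, d.1 1), by
        have := d.2
        simpa [Finsupp.degree_eq_sum] using this⟩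
      invFun := fun x => ⟨Finsupp.equivFunOnFinite.symm ![x.1.1, x.1.2], by
        have := Finset.HasAntidiagonal.mem_antidiagonal.1 x.2
        simpa [Finsupp.degree_eq_sum] using this⟩
      left_inv := by
        rintro ⟨d, hd⟩
        ext i
        fin_cases i <;> simp
      right_inv := by
        rintro ⟨⟨a, b⟩, hd⟩
        simp }
  rw [(Finsupp.domLCongr e).finrank_eq, Module.finrank_finsupp_self]
  simp

instance (n : ℕ) : Module.Finite ℂ (homogeneousSubmodule (Fin 2) ℂ n) :=
  Module.finite_of_finrank_pos (by rw [finrank_homog]; omega)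

lemma dim_sum (d M : ℕ) : ∑ t : Fin (M + 1), (d + 2 * (t : ℕ) + 1) = (d + M + 1) * (M + 1) := by
  rw [Fin.sum_univ_eq_sum_range (fun t => d + 2 * t + 1)]
  induction M with
  | zero => simp
  | succ M ih => rw [Finset.sum_range_succ, ih]; ring

/-- projection to the homogeneous submodule -/
noncomputable def pr (n : ℕ) : P →ₗ[ℂ] homogeneousSubmodule (Fin 2) ℂ n :=
  (homogeneousComponent n).codRestrict _ (fun p => homogeneousComponent_mem n p)

noncomputable def S (n₁ n₂ k d : ℕ) :
    homogeneousSubmodule (Fin 2) ℂ d →ₗ[ℂ]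
      homogeneousSubmodule (Fin 2) ℂ n₁ ⊗[ℂ] homogeneousSubmodule (Fin 2) ℂ n₂ :=
  TensorProduct.map (pr n₁) (pr n₂) ∘ₗ LinearMap.mulLeft ℂ (D ^ k) ∘ₗ
    Delta.toLinearMap ∘ₗ Submodule.subtype _

lemma incl_S (n₁ n₂ k d : ℕ) (f : homogeneousSubmodule (Fin 2) ℂ d) :
    TensorProduct.map (Submodule.subtype _) (Submodule.subtype _) (S n₁ n₂ k d f)
      = bi n₁ n₂ (D ^ k * Delta f) := by
  change (TensorProduct.map _ _ ∘ₗ TensorProduct.map _ _) _ = _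
  rw [← TensorProduct.map_comp]
  rfl

noncomputable def SS (n₁ n₂ : ℕ) :
    (∀ t : Fin (min n₁ n₂ + 1),
          homogeneousSubmodule (Fin 2) ℂ (max n₁ n₂ - min n₁ n₂ + 2 * (t : ℕ))) →ₗ[ℂ]
    (homogeneousSubmodule (Fin 2) ℂ n₁ ⊗[ℂ] homogeneousSubmodule (Fin 2) ℂ n₂) :=
  ∑ t : Fin (min n₁ n₂ + 1), S n₁ n₂ (t.rev : ℕ) _ ∘ₗ LinearMap.proj t

lemma SS_apply (n₁ n₂ : ℕ) (f) :
    SS n₁ n₂ f = ∑ t : Fin (min n₁ n₂ + 1), S n₁ n₂ (t.rev : ℕ) _ (f t) := by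
  simp [SS]

lemma SS_inj (n₁ n₂ : ℕ) : Function.Injective (SS n₁ n₂) := by
  refine (injective_iff_map_eq_zero _).2 ?_
  intro f hf
  have h := congrArg (TensorProduct.map (Submodule.subtype _) (Submodule.subtype _)) hf
  rw [SS_apply, map_sum, map_zero] at h
  simp only [incl_S] at h
  let w : Fin (min n₁ n₂ + 1) → P ⊗[ℂ] P := fun k =>
    bi (n₁ - (k : ℕ)) (n₂ - (k : ℕ)) (Delta (f k.rev))
  have key : ∀ k, mu (w k) = 0 → f k.rev = 0 := by
    intro k hk
    have hk2 := k.2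
    have hd : n₁ - (k : ℕ) + (n₂ - (k : ℕ)) =
        max n₁ n₂ - min n₁ n₂ + 2 * (k.rev : ℕ) := by
      rw [Fin.val_rev]; omega
    simp only [w] at hk
    rw [mu_bi_Delta, homogeneousComponent_of_mem (f k.rev).2, if_pos hd] at hk
    have hc : (((n₁ - (k : ℕ) + (n₂ - (k : ℕ))).choose (n₁ - (k : ℕ)) : ℕ) : P) ≠ 0 := by
      rw [Nat.cast_ne_zero]
      exact (Nat.choose_pos (Nat.le_add_right _ _)).ne'
    exact Subtype.ext ((mul_eq_zero.1 hk).resolve_left hc)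
  have hw := peel _ w (fun k hk => by simp [w, key k hk]) (by
    rw [← h, ← Equiv.sum_comp Fin.revPerm]
    refine Finset.sum_congr rfl fun t _ => ?_
    simp only [w, Fin.revPerm_apply]
    rw [← bi_D_pow_mul]
    have := t.2
    rw [Fin.rev_rev, Nat.sub_add_cancel (by omega), Nat.sub_add_cancel (by omega)])
  funext t
  have := key t.rev (by rw [hw, map_zero])
  rw [Fin.rev_rev] at this
  exact this

lemma surj_of_inj {V W : Type*} [AddCommMonoid V] [AddCommMonoid W] [Module ℂ V] [Module ℂ W]
    [Module.Finite ℂ V] [Module.Finite ℂ W] (f : V →ₗ[ℂ] W) (hf : Function.Injective f)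
    (h : Module.finrank ℂ V = Module.finrank ℂ W) : Function.Surjective f := by
  letI := Module.addCommMonoidToAddCommGroup ℂ (M := V)
  letI := Module.addCommMonoidToAddCommGroup ℂ (M := W)
  exact (LinearMap.injective_iff_surjective_of_finrank_eq_finrank h).1 hf

lemma SS_bij (n₁ n₂ : ℕ) : Function.Bijective (SS n₁ n₂) := by
  refine ⟨SS_inj n₁ n₂, ?_⟩
  refine surj_of_inj _ (SS_inj n₁ n₂) ?_
  rw [Module.finrank_pi_fintype, Module.finrank_tensorProduct]
  simp only [finrank_homog]
  rw [dim_sum]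
  rcases le_total n₁ n₂ with h | h
  · rw [max_eq_right h, min_eq_left h, Nat.sub_add_cancel h, mul_comm]
  · rw [max_eq_left h, min_eq_right h, Nat.sub_add_cancel h]

section equiv

variable (A : Matrix (Fin 2) (Fin 2) ℂ)

noncomputable def sg : P →ₐ[ℂ] P := aeval (fun i => ∑ j, C (A i j) * X j)

lemma sg_X (i : Fin 2) : sg A (X i) = ∑ j, C (A i j) * X j := by simp [sg]

noncomputable def sg2 : P ⊗[ℂ] P →ₐ[ℂ] P ⊗[ℂ] P := Algebra.TensorProduct.map (sg A) (sg A)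

lemma C_tmul (a : ℂ) (p q : P) : (C a * p) ⊗ₜ[ℂ] q = a • (p ⊗ₜ[ℂ] q) := by
  rw [← smul_eq_C_mul, TensorProduct.smul_tmul']

lemma tmul_C (a : ℂ) (p q : P) : p ⊗ₜ[ℂ] (C a * q) = a • (p ⊗ₜ[ℂ] q) := by
  rw [← smul_eq_C_mul, TensorProduct.tmul_smul]

lemma sg2_D (hA : A.det = 1) : sg2 A D = D := by
  rw [Matrix.det_fin_two] at hA
  simp only [sg2, D, map_sub, Algebra.TensorProduct.map_tmul, sg_X, Fin.sum_univ_two,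
    TensorProduct.add_tmul, TensorProduct.tmul_add, C_tmul, tmul_C]
  have hA2 : A 0 0 * A 1 1 = 1 + A 0 1 * A 1 0 := by linear_combination hA
  simp only [smul_add, smul_smul, mul_comm (A 1 1), mul_comm (A 1 0), hA2]
  module

lemma Delta_sg (p : P) : Delta (sg A p) = sg2 A (Delta p) := by
  have : Delta.comp (sg A) = (sg2 A).comp Delta := by
    apply MvPolynomial.algHom_ext
    intro i
    simp [sg_X, Delta, sg2, TensorProduct.add_tmul, TensorProduct.tmul_add,
      ← smul_eq_C_mul, TensorProduct.smul_tmul']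
    abel
  exact DFunLike.congr_fun this p

lemma comp_sg (n : ℕ) (p : P) :
    homogeneousComponent n (sg A p) = sg A (homogeneousComponent n p) :=
  comp_aeval _ (fun i => IsHomogeneous.sum _ _ _ fun j _ => isHomogeneous_C_mul_X _ _) n p

end equiv

end CG


/-- Clebsch–Gordan decomposition: the tensor product of the irreducible SU(2)
representations H^{j₁} and H^{j₂} is equivalent to the direct sum of the irreducible
representations H^J for J = |j₁ − j₂|, |j₁ − j₂| + 1, …, j₁ + j₂, each occurring once.
(In integer parameters nᵢ = 2jᵢ, the summands are H^{|n₁ − n₂| + 2t}, 0 ≤ t ≤ min n₁ n₂.) -/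
theorem stmt11 (n₁ n₂ : ℕ)
    (ρ : ∀ n : ℕ, Matrix.specialUnitaryGroup (Fin 2) ℂ →
      (homogeneousSubmodule (Fin 2) ℂ n →ₗ[ℂ] homogeneousSubmodule (Fin 2) ℂ n))
    (hρ : ∀ (n : ℕ) (g : Matrix.specialUnitaryGroup (Fin 2) ℂ)
        (f : homogeneousSubmodule (Fin 2) ℂ n),
      (ρ n g f : MvPolynomial (Fin 2) ℂ) = aeval
        (fun i => ∑ j, C (((g : Matrix (Fin 2) (Fin 2) ℂ))⁻¹ i j) * X j)
        (f : MvPolynomial (Fin 2) ℂ)) :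
    ∃ T : (homogeneousSubmodule (Fin 2) ℂ n₁ ⊗[ℂ] homogeneousSubmodule (Fin 2) ℂ n₂) ≃ₗ[ℂ]
        (∀ t : Fin (min n₁ n₂ + 1),
          homogeneousSubmodule (Fin 2) ℂ (max n₁ n₂ - min n₁ n₂ + 2 * (t : ℕ))),
      ∀ (g : Matrix.specialUnitaryGroup (Fin 2) ℂ)
        (x : homogeneousSubmodule (Fin 2) ℂ n₁ ⊗[ℂ] homogeneousSubmodule (Fin 2) ℂ n₂)
        (t : Fin (min n₁ n₂ + 1)),
        T (TensorProduct.map (ρ n₁ g) (ρ n₂ g) x) t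
          = ρ (max n₁ n₂ - min n₁ n₂ + 2 * (t : ℕ)) g (T x t) := by
  have hS : ∀ (g : Matrix.specialUnitaryGroup (Fin 2) ℂ) (k d : ℕ)
      (f : homogeneousSubmodule (Fin 2) ℂ d),
      TensorProduct.map (ρ n₁ g) (ρ n₂ g) (CG.S n₁ n₂ k d f) = CG.S n₁ n₂ k d (ρ d g f) := by
    intro g k d f
    have hdet : ((g : Matrix (Fin 2) (Fin 2) ℂ)⁻¹).det = 1 := by
      rw [Matrix.det_nonsing_inv, (Matrix.mem_specialUnitaryGroup_iff.1 g.2).2]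
      simp
    have hpr : ∀ n, (ρ n g) ∘ₗ CG.pr n =
        CG.pr n ∘ₗ (CG.sg (g : Matrix (Fin 2) (Fin 2) ℂ)⁻¹).toLinearMap := by
      intro n
      refine LinearMap.ext fun p => Subtype.ext ?_
      rw [LinearMap.comp_apply, hρ]
      exact (CG.comp_sg _ n p).symm
    have hf : ((ρ d g f : homogeneousSubmodule (Fin 2) ℂ d) : MvPolynomial (Fin 2) ℂ)
        = CG.sg (g : Matrix (Fin 2) (Fin 2) ℂ)⁻¹ f := hρ d g f
    simp only [CG.S, LinearMap.comp_apply, Submodule.subtype_apply, hf,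
      AlgHom.toLinearMap_apply, CG.Delta_sg, LinearMap.mulLeft_apply]
    rw [← LinearMap.comp_apply, ← TensorProduct.map_comp, hpr, hpr, TensorProduct.map_comp,
      LinearMap.comp_apply]
    congr 1
    change CG.sg2 _ _ = _
    rw [map_mul, map_pow, CG.sg2_D _ hdet]
  refine ⟨(LinearEquiv.ofBijective (CG.SS n₁ n₂) (CG.SS_bij n₁ n₂)).symm, ?_⟩
  intro g x t
  obtain ⟨f, rfl⟩ := (LinearEquiv.ofBijective (CG.SS n₁ n₂) (CG.SS_bij n₁ n₂)).surjective x
  have h : TensorProduct.map (ρ n₁ g) (ρ n₂ g)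
      (LinearEquiv.ofBijective (CG.SS n₁ n₂) (CG.SS_bij n₁ n₂) f)
      = LinearEquiv.ofBijective (CG.SS n₁ n₂) (CG.SS_bij n₁ n₂) (fun t => ρ _ g (f t)) := by
    simp only [LinearEquiv.ofBijective_apply, CG.SS_apply, map_sum, hS]
  rw [h, LinearEquiv.symm_apply_apply, LinearEquiv.symm_apply_apply]
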